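/- For every n, the unitary group Matrix.unitaryGroup (Fin n) ℂ, with the subspace topology inherited from the space of n×n complex matrices, is path-connected. (This is the statement π₀(U(n)) = 0, the even-degree entry i = 0 of the paper's description via Bott periodicity that π_i(U) is trivial for i even.) -/

import Mathlib

open Complex in
/-- A unitary element of a C⋆-algebra with finite spectrum is the exponential of its argument. -/
lemma Unitary.expUnitary_argSelfAdjoint_of_finite_spectrum {A : Type*} [CStarAlgebra A]
    {u : unitary A} (hu : (spectrum ℂ (u : A)).Finite) :
    selfAdjoint.expUnitary (Unitary.argSelfAdjoint u) = u := by
  ext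
  have h_arg : ContinuousOn arg (spectrum ℂ (u : A)) := hu.continuousOn _
  rw [selfAdjoint.expUnitary_coe, Unitary.argSelfAdjoint_coe,
    ← CFC.exp_eq_normedSpace_exp (𝕜 := ℂ), ← cfc_comp_smul .., ← cfc_comp' ..]
  conv_rhs => rw [← cfc_id' ℂ (u : A)]
  refine cfc_congr fun y hy ↦ ?_
  have hy_norm : ‖y‖ = 1 := spectrum.norm_eq_one_of_unitary u.2 hy
  have h_log : I * y.arg = log y := Complex.ext (by simp [log_re, hy_norm]) (by simp [log_im])
  have hy_ne : y ≠ 0 := norm_ne_zero_iff.mp (by simp [hy_norm])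
  simpa [← exp_eq_exp_ℂ, h_log] using exp_log hy_ne

/-- A unitary element of a C⋆-algebra with finite spectrum is joined to `1` by a path of
unitaries. -/
lemma Unitary.joined_one_of_finite_spectrum {A : Type*} [CStarAlgebra A]
    {u : unitary A} (hu : (spectrum ℂ (u : A)).Finite) : Joined 1 u :=
  Unitary.expUnitary_argSelfAdjoint_of_finite_spectrum hu ▸
    selfAdjoint.joined_one_expUnitary (Unitary.argSelfAdjoint u)

open scoped Matrix.Norms.L2Operator in
/-- Every unitary matrix is joined to `1` by a path of unitary matrices. -/
lemma Matrix.joined_one_unitaryGroup {m : Type*} [Fintype m] [DecidableEq m]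
    (u : Matrix.unitaryGroup m ℂ) : Joined 1 u :=
  Unitary.joined_one_of_finite_spectrum (Matrix.finite_spectrum (u : Matrix m m ℂ))

/-- The unitary group `U(n)`, with its subspace topology from the `n×n` complex matrices,
is path-connected. -/
theorem pathConnectedSpace_unitaryGroup (n : ℕ) :
    PathConnectedSpace (Matrix.unitaryGroup (Fin n) ℂ) where
  nonempty := ⟨1⟩
  joined u v := (Matrix.joined_one_unitaryGroup u).symm.trans (Matrix.joined_one_unitaryGroup v)
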